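/- arXiv:math/0112196 — 3 statements merged into one kernel-verified Lean document; each statement's English description precedes it below -/
import Mathlib

section
/- Let g : ℝ → ℝ be an even, continuous, integrable function whose Fourier transform ĝ(r) = ∫_ℝ g(x) e^{irx} dx is integrable on ℝ and satisfies ĝ(t) > 0 for every real t. Then for every complex number r with |Im r| < 1/2, the integral ∫_ℝ (g(x)/cosh(x/2)) e^{irx} dx converges absolutely and its real part is strictly positive. -/
open MeasureTheory Real

lemma aux_pt (s : ℂ) (x : ℝ) :
    |sigmoid x * (1 - sigmoid x)| • (((sigmoid x : ℝ) : ℂ) ^ (s - 1) *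
      (1 - ((sigmoid x : ℝ) : ℂ)) ^ ((1 - s) - 1)) =
    Complex.exp (s * x) / (1 + Complex.exp x) := by
  have h0 := sigmoid_pos x
  have h1 : 0 < 1 - sigmoid x := by linarith [sigmoid_lt_one x]
  have hE : 0 < Real.exp x := Real.exp_pos x
  have hs : sigmoid x = Real.exp x * (1 - sigmoid x) := by
    rw [sigmoid_def, Real.exp_neg]; field_simp; ring
  have hs2 : 1 - sigmoid x = (1 + Real.exp x)⁻¹ := by
    rw [sigmoid_def, Real.exp_neg]; field_simp; ring
  set u := 1 - sigmoid x with hu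
  have hc : (1 - ((sigmoid x : ℝ) : ℂ)) = (u : ℂ) := by rw [hu]; push_cast; ring
  have hune : (u : ℂ) ≠ 0 := by exact_mod_cast h1.ne'
  have hEne : Complex.exp x ≠ 0 := Complex.exp_ne_zero _
  rw [hc, abs_of_pos (mul_pos h0 h1), hs, Complex.real_smul]
  push_cast
  rw [← Complex.ofReal_exp, Complex.mul_cpow_ofReal_nonneg hE.le h1.le]
  have e1 : ((Real.exp x : ℝ) : ℂ) ^ (s - 1) = Complex.exp (s * x) / Complex.exp x := by
    rw [Complex.cpow_def_of_ne_zero (by exact_mod_cast hE.ne'), ← Complex.ofReal_log hE.le,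
      Real.log_exp, ← Complex.exp_sub]
    congr 1; ring
  have e2 : (u : ℂ) ^ (s - 1) * (u : ℂ) ^ ((1 - s) - 1) = (u : ℂ)⁻¹ := by
    rw [← Complex.cpow_add _ _ hune, ← Complex.cpow_neg_one]
    congr 1; ring
  have e3 : (1 + Complex.exp x) = (u : ℂ)⁻¹ := by
    rw [hs2]; push_cast; simp
  rw [e1, mul_assoc (_ / _), e2, Complex.ofReal_exp, e3]
  field_simp

lemma aux_beta (s : ℂ) (h0 : 0 < s.re) (h1 : s.re < 1) :
    Integrable (fun x : ℝ => Complex.exp (s * x) / (1 + Complex.exp x)) ∧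
    ∫ x : ℝ, Complex.exp (s * x) / (1 + Complex.exp x) = π / Complex.sin (π * s) := by
  have h1' : 0 < (1 - s).re := by simp; linarith
  have himg : sigmoid '' Set.univ = Set.Ioo 0 1 := by rw [Set.image_univ]; exact range_sigmoid
  have hder : ∀ x ∈ Set.univ, HasDerivWithinAt sigmoid (sigmoid x * (1 - sigmoid x)) Set.univ x :=
    fun x _ => (hasDerivAt_sigmoid x).hasDerivWithinAt
  have hconv := Complex.betaIntegral_convergent h0 h1'
  rw [intervalIntegrable_iff_integrableOn_Ioo_of_le zero_le_one] at hconv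
  constructor
  · rw [← himg, integrableOn_image_iff_integrableOn_abs_deriv_smul MeasurableSet.univ hder
      sigmoid_injective.injOn, integrableOn_univ] at hconv
    simpa only [aux_pt] using hconv
  · have hG := Complex.Gamma_mul_Gamma_eq_betaIntegral h0 h1'
    rw [Complex.Gamma_mul_Gamma_one_sub, add_sub_cancel, Complex.Gamma_one, one_mul,
      Complex.betaIntegral, intervalIntegral.integral_of_le zero_le_one,
      integral_Ioc_eq_integral_Ioo, ← himg,
      integral_image_eq_integral_abs_deriv_smul MeasurableSet.univ hder
      sigmoid_injective.injOn, setIntegral_univ] at hG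
    simp only [aux_pt] at hG
    exact hG.symm

lemma aux_k (z : ℂ) (hz : |z.im| < 1/2) :
    Integrable (fun x : ℝ => Complex.exp (Complex.I * z * x) / Complex.cosh (x/2)) ∧
    0 < (∫ x : ℝ, Complex.exp (Complex.I * z * x) / Complex.cosh (x/2)).re := by
  obtain ⟨ha, hb⟩ := abs_lt.mp hz
  obtain ⟨hi, hv⟩ := aux_beta (1/2 + Complex.I * z) (by simp; linarith) (by simp; linarith)
  have hfun : (fun x : ℝ => Complex.exp (Complex.I * z * x) / Complex.cosh (x/2)) =
      fun x : ℝ => 2 * (Complex.exp ((1/2 + Complex.I * z) * x) / (1 + Complex.exp x)) := by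
    funext x
    have hE := Complex.exp_ne_zero ((x:ℂ)/2)
    have e1 : Complex.exp ((1/2 + Complex.I * z) * x) =
        Complex.exp ((x:ℂ)/2) * Complex.exp (Complex.I * z * x) := by
      rw [← Complex.exp_add]; congr 1; ring
    have e2 : Complex.exp x = Complex.exp ((x:ℂ)/2) * Complex.exp ((x:ℂ)/2) := by
      rw [← Complex.exp_add]; congr 1; ring
    have e3 : (1 + Complex.exp x) ≠ 0 := by
      have : 0 < 1 + Real.exp x := by positivity
      exact_mod_cast this.ne'
    have e4 : Complex.cosh (x/2) = (1 + Complex.exp x) / (2 * Complex.exp ((x:ℂ)/2)) := by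
      rw [Complex.cosh, Complex.exp_neg, e2]; field_simp; ring
    rw [e4, e1]; field_simp
  rw [hfun]
  refine ⟨hi.const_mul 2, ?_⟩
  rw [integral_const_mul, hv]
  have hsin : Complex.sin (π * (1/2 + Complex.I * z)) = Complex.cosh (π * z) := by
    rw [← Complex.cos_mul_I, ← Complex.sin_add_pi_div_two]; congr 1; ring
  rw [hsin]
  have hre : 0 < (Complex.cosh (π * z)).re := by
    have : (Complex.cosh (π * z)).re = Real.cosh (π * z.re) * Real.cos (π * z.im) := by
      have : (π * z : ℂ) = ((π * z.re : ℝ) : ℂ) + ((π * z.im : ℝ) : ℂ) * Complex.I := by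
        conv_lhs => rw [← Complex.re_add_im z]
        push_cast; ring
      rw [this, Complex.cosh_add, Complex.cosh_mul_I, Complex.sinh_mul_I,
        ← Complex.ofReal_cosh, ← Complex.ofReal_cos, ← Complex.ofReal_sinh, ← Complex.ofReal_sin]
      simp [-Complex.ofReal_cosh, -Complex.ofReal_cos, -Complex.ofReal_sinh, -Complex.ofReal_sin]
    rw [this]
    refine mul_pos (Real.cosh_pos _) (Real.cos_pos_of_mem_Ioo ⟨?_, ?_⟩) <;>
      nlinarith [Real.pi_pos]
  have : (2 * ((π : ℂ) / Complex.cosh (π * z))) = ((2 * π : ℝ) : ℂ) * (Complex.cosh (π * z))⁻¹ := by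
    push_cast; ring
  rw [this, Complex.re_ofReal_mul, Complex.inv_re]
  have hne : Complex.cosh (π * z) ≠ 0 := by
    intro h; rw [h] at hre; simp at hre
  exact mul_pos (by positivity) (div_pos hre (Complex.normSq_pos.mpr hne))

open FourierTransform in
theorem stmt_0 (g : ℝ → ℝ)
    (heven : ∀ x : ℝ, g (-x) = g x)
    (hcont : Continuous g)
    (hint : Integrable g)
    (hftint : Integrable (fun r : ℝ => ∫ x : ℝ, (g x : ℂ) * Complex.exp (Complex.I * r * x)))
    (hftpos : ∀ t : ℝ, 0 < (∫ x : ℝ, (g x : ℂ) * Complex.exp (Complex.I * t * x)).re)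
    (r : ℂ) (hr : |r.im| < 1/2) :
    Integrable (fun x : ℝ => ((g x / Real.cosh (x/2) : ℝ) : ℂ) * Complex.exp (Complex.I * r * x)) ∧
    0 < (∫ x : ℝ, ((g x / Real.cosh (x/2) : ℝ) : ℂ) * Complex.exp (Complex.I * r * x)).re := by
  set f : ℝ → ℂ := fun x => (g x : ℂ) with hf
  set h : ℝ → ℂ := fun x => Complex.exp (Complex.I * r * x) / Complex.cosh (x/2) with hh
  have hfi : Integrable f := hint.ofReal
  have hfc : Continuous f := Complex.continuous_ofReal.comp hcont
  have hhi : Integrable h := (aux_k r hr).1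
  have hfun : (fun x : ℝ => ((g x / Real.cosh (x/2) : ℝ) : ℂ) * Complex.exp (Complex.I * r * x))
      = fun x => f x * h x := by
    funext x; simp only [hf, hh]; push_cast; ring
  rw [hfun]
  have hbd : ∀ x, ‖h x‖ ≤ 2 := by
    intro x
    have hc : Complex.cosh (x/2) = ((Real.cosh (x/2) : ℝ) : ℂ) := by push_cast; rfl
    simp only [hh]
    rw [hc, norm_div, Complex.norm_exp, Complex.norm_real, Real.norm_of_nonneg (Real.cosh_pos _).le,
      div_le_iff₀ (Real.cosh_pos _), Real.cosh_eq]
    have : (Complex.I * r * x).re = - r.im * x := by simp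
    rw [this]
    obtain ⟨ha, hb⟩ := abs_lt.mp hr
    have p1 := Real.exp_pos (x/2)
    have p2 := Real.exp_pos (-(x/2))
    rcases le_total 0 x with hx | hx
    · have : Real.exp (-r.im * x) ≤ Real.exp (x/2) := Real.exp_le_exp.mpr (by nlinarith)
      linarith
    · have : Real.exp (-r.im * x) ≤ Real.exp (-(x/2)) := Real.exp_le_exp.mpr (by nlinarith)
      linarith
  refine ⟨hfi.mul_bdd hhi.aestronglyMeasurable (Filter.Eventually.of_forall hbd), ?_⟩
  have hF : ∀ v : ℝ, 𝓕 f v =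
      ∫ x : ℝ, (g x : ℂ) * Complex.exp (Complex.I * ((-2 * π * v : ℝ) : ℂ) * x) := by
    intro v
    rw [Real.fourier_real_eq_integral_exp_smul]
    refine integral_congr_ae (Filter.Eventually.of_forall fun x => ?_)
    simp only [hf, smul_eq_mul]
    rw [mul_comm]; congr 2; push_cast; ring
  have hFi : Integrable (𝓕 f) := by
    have := hftint.comp_mul_left' (R := -2 * π) (by simp [Real.pi_ne_zero])
    refine this.congr (Filter.Eventually.of_forall fun v => ?_)
    simp only [hF]
  have hFpos : ∀ v, 0 < (𝓕 f v).re := fun v => by rw [hF]; exact hftpos _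
  have hFim : ∀ v, (𝓕 f v).im = 0 := by
    intro v
    rw [← Complex.conj_eq_iff_im, hF, ← integral_conj, ← integral_neg_eq_self]
    refine integral_congr_ae (Filter.Eventually.of_forall fun x => ?_)
    have h2 : (starRingEnd ℂ) 2 = 2 := Complex.conj_ofNat 2
    simp [heven, ← Complex.exp_conj, h2]
  have hinv : f = 𝓕 (𝓕 f) := by
    funext x
    have h1 := congrFun (hfc.fourierInv_fourier_eq hfi hFi) (-x)
    rw [Real.fourierInv_eq_fourier_neg, neg_neg] at h1
    rw [h1]; simp [hf, heven]
  have hadj : ∫ x, f x * h x = ∫ v, 𝓕 f v * 𝓕 h v := by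
    have := VectorFourier.integral_fourierIntegral_smul_eq_flip (L := innerₗ ℝ) (μ := volume)
      (ν := volume) Real.continuous_fourierChar continuous_inner hFi hhi
    rw [flip_innerₗ] at this
    conv_lhs => rw [hinv]
    exact this
  have hHc : Continuous (𝓕 h) :=
    VectorFourier.fourierIntegral_continuous Real.continuous_fourierChar
      (L := innerₗ ℝ) continuous_inner hhi
  have hHb : ∀ v, ‖𝓕 h v‖ ≤ ∫ x, ‖h x‖ := fun v =>
    VectorFourier.norm_fourierIntegral_le_integral_norm _ _ _ _ _
  have hprod : Integrable (fun v => 𝓕 f v * 𝓕 h v) :=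
    hFi.mul_bdd hHc.aestronglyMeasurable (Filter.Eventually.of_forall hHb)
  have hHpos : ∀ v, 0 < (𝓕 h v).re := by
    intro v
    have hz := (aux_k (r - ((2 * π * v : ℝ) : ℂ)) (by simpa using hr)).2
    convert hz using 2
    rw [Real.fourier_real_eq_integral_exp_smul]
    refine integral_congr_ae (Filter.Eventually.of_forall fun x => ?_)
    simp only [hh, smul_eq_mul]
    rw [← mul_div_assoc, ← Complex.exp_add]
    congr 2; push_cast; ring
  rw [hadj]
  have hpos : ∀ v, 0 < (𝓕 f v * 𝓕 h v).re := by
    intro v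
    rw [Complex.mul_re, hFim, zero_mul, sub_zero]
    exact mul_pos (hFpos v) (hHpos v)
  have hre : (∫ v, 𝓕 f v * 𝓕 h v).re = ∫ v, (𝓕 f v * 𝓕 h v).re := (integral_re hprod).symm
  rw [hre, integral_pos_iff_support_of_nonneg (fun v => (hpos v).le) hprod.re]
  have : (Function.support fun v => (𝓕 f v * 𝓕 h v).re) = Set.univ := by
    ext v; simpa using (hpos v).ne'
  rw [this]; simp
end

section
/- Let ν ∈ ℂ be purely imaginary (Re ν = 0), let C ≥ 0, A ≥ 0, and let a : {1,2,3,...} → ℂ satisfy |a_n| ≤ C·n^A for all n ≥ 1. Then for every s ∈ ℂ with Re s > A + 1: the series Σ_{n≥1} a_n K_ν(2πny) converges absolutely for each y > 0, the function y ↦ Σ_{n≥1} a_n K_ν(2πny) times y^{s-1} is integrable on (0,∞), the Dirichlet series Σ_{n≥1} a_n n^{-s} converges absolutely, and ∫_0^∞ (Σ_{n≥1} a_n K_ν(2πny)) y^s dy/y = (1/4)·π^{-s}·Γ((s+ν)/2)·Γ((s-ν)/2)·Σ_{n≥1} a_n n^{-s}. -/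
open MeasureTheory Real

/-- The K-Bessel function of order `ν`, defined for `y > 0` by
`K_ν(y) = (1/2)∫_0^∞ e^{-y(t+1/t)/2} t^ν dt/t`. -/
noncomputable def besselK (ν : ℂ) (y : ℝ) : ℂ :=
  (1/2) * ∫ t in Set.Ioi (0:ℝ), (Real.exp (-(y * (t + 1/t) / 2)) : ℂ) * (t : ℂ) ^ (ν - 1)

open Set Function

lemma aux_pt_s8 {F G : ℝ → ℝ → ℂ}
    (h : ∀ x, 0 < x → ∀ t, 0 < t → G x t = (2 * t : ℝ) * F (2 * t * x) t) (t : ℝ) (ht : 0 < t) :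
    (∫ x in Ioi (0:ℝ), G x t) = ∫ y in Ioi (0:ℝ), F y t := by
  have h2 : 0 < 2 * t := by positivity
  have := integral_comp_mul_left_Ioi (fun y => F y t) 0 h2
  rw [setIntegral_congr_fun measurableSet_Ioi (fun x hx => h x hx t ht), integral_const_mul, this,
    mul_zero, Complex.real_smul, ← mul_assoc, ← Complex.ofReal_mul, mul_inv_cancel₀ h2.ne',
    Complex.ofReal_one, one_mul]

lemma aux_pt_norm {F G : ℝ → ℝ → ℂ}
    (h : ∀ x, 0 < x → ∀ t, 0 < t → G x t = (2 * t : ℝ) * F (2 * t * x) t) (t : ℝ) (ht : 0 < t) :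
    (∫ x in Ioi (0:ℝ), ‖G x t‖) = ∫ y in Ioi (0:ℝ), ‖F y t‖ := by
  have h2 : 0 < 2 * t := by positivity
  have := integral_comp_mul_left_Ioi (fun y => ‖F y t‖) 0 h2
  have h' : ∀ x ∈ Ioi (0:ℝ), ‖G x t‖ = (2 * t) * ‖F (2 * t * x) t‖ := by
    intro x hx
    rw [h x hx t ht, norm_mul, Complex.norm_real, Real.norm_of_nonneg h2.le]
  rw [setIntegral_congr_fun measurableSet_Ioi h', integral_const_mul, this,
    mul_zero, smul_eq_mul, ← mul_assoc, mul_inv_cancel₀ h2.ne', one_mul]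

lemma aux_scale {F G : ℝ → ℝ → ℂ} (hF : Measurable (uncurry F))
    (hG : Integrable (uncurry G) ((volume.restrict (Ioi (0:ℝ))).prod (volume.restrict (Ioi (0:ℝ)))))
    (h : ∀ x, 0 < x → ∀ t, 0 < t → G x t = (2 * t : ℝ) * F (2 * t * x) t) :
    Integrable (uncurry F) ((volume.restrict (Ioi (0:ℝ))).prod (volume.restrict (Ioi (0:ℝ)))) ∧
    (∫ y in Ioi (0:ℝ), ∫ t in Ioi (0:ℝ), F y t) = ∫ x in Ioi (0:ℝ), ∫ t in Ioi (0:ℝ), G x t := by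
  have hFi : Integrable (uncurry F)
      ((volume.restrict (Ioi (0:ℝ))).prod (volume.restrict (Ioi (0:ℝ)))) := by
    rw [integrable_prod_iff' hF.aestronglyMeasurable]
    rw [integrable_prod_iff' hG.aestronglyMeasurable] at hG
    constructor
    · filter_upwards [hG.1, ae_restrict_mem measurableSet_Ioi] with t h1 ht
      have h2 : 0 < 2 * t := by have : 0 < t := ht; positivity
      have h3 := integrableOn_Ioi_comp_mul_left_iff (fun y => F y t) 0 h2
      rw [mul_zero] at h3
      refine h3.1 ?_
      refine (IntegrableOn.congr_fun (h1.const_mul (((2 * t : ℝ) : ℂ)⁻¹)) (fun x hx => ?_)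
        measurableSet_Ioi)
      simp only [uncurry]
      rw [h x hx t ht, ← mul_assoc, inv_mul_cancel₀ (by exact_mod_cast h2.ne'), one_mul]
    · refine IntegrableOn.congr_fun hG.2 (fun t ht => ?_) measurableSet_Ioi
      exact aux_pt_norm h t ht
  refine ⟨hFi, ?_⟩
  rw [integral_integral_swap hFi, integral_integral_swap hG]
  exact setIntegral_congr_fun measurableSet_Ioi (fun t ht => (aux_pt_s8 h t ht).symm)

lemma aux_gauss {w : ℂ} {x : ℝ} (hw : 0 < w.re) (hx : 0 < x) :
    (∫ t in Ioi (0:ℝ), (t:ℂ) ^ (w - 1) * (Real.exp (-(x * t ^ 2)) : ℂ))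
      = (1/2) * ((1 / x : ℂ) ^ (w/2) * Complex.Gamma (w/2)) := by
  have h := mellin_comp_rpow (fun u => (Real.exp (-(x * u)) : ℂ)) w 2
  have h2 := Complex.integral_cpow_mul_exp_neg_mul_Ioi (a := w / 2) (r := x) (by simpa using hw) hx
  simp only [mellin, smul_eq_mul] at h
  push_cast at h ⊢
  rw [h2] at h
  simp at h ⊢
  exact h

lemma aux_gauss_int {w : ℂ} {x : ℝ} (hw : 0 < w.re) (hx : 0 < x) :
    IntegrableOn (fun t : ℝ => (t:ℂ) ^ (w - 1) * (Real.exp (-(x * t ^ 2)) : ℂ)) (Ioi 0) := by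
  have h := integrableOn_rpow_mul_exp_neg_mul_sq (b := x) hx (s := w.re - 1) (by linarith)
  refine Integrable.mono' h (by fun_prop) ?_
  filter_upwards [ae_restrict_mem measurableSet_Ioi] with t ht
  rw [norm_mul, Complex.norm_real, Complex.norm_cpow_eq_rpow_re_of_pos ht,
    Real.norm_of_nonneg (Real.exp_pos _).le]
  simp

lemma aux_gauss_norm {w : ℂ} {x : ℝ} (hw : 0 < w.re) (hx : 0 < x) :
    (∫ t in Ioi (0:ℝ), ‖(t:ℂ) ^ (w - 1) * (Real.exp (-(x * t ^ 2)) : ℂ)‖)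
      = x ^ (-(w.re / 2)) * (1 / 2) * Real.Gamma (w.re / 2) := by
  have h := integral_rpow_mul_exp_neg_mul_rpow (p := 2) (q := w.re - 1) (b := x) two_pos
    (by linarith) hx
  have e : ∀ t ∈ Ioi (0:ℝ), ‖(t:ℂ) ^ (w - 1) * (Real.exp (-(x * t ^ 2)) : ℂ)‖
      = t ^ (w.re - 1) * rexp (-x * t ^ (2:ℝ)) := by
    intro t ht
    rw [norm_mul, Complex.norm_real, Complex.norm_cpow_eq_rpow_re_of_pos ht,
      Real.norm_of_nonneg (Real.exp_pos _).le]
    simp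
  rw [setIntegral_congr_fun measurableSet_Ioi e, h]
  simp [neg_div]

noncomputable def auxG (s ν : ℂ) (x t : ℝ) : ℂ :=
  ((2:ℂ) ^ s * ((Real.exp (-x) : ℂ) * (x:ℂ) ^ (s - 1))) *
    ((t:ℂ) ^ (s + ν - 1) * (Real.exp (-(x * t ^ 2)) : ℂ))

lemma auxG_int {s ν : ℂ} (hν : ν.re = 0) (hs : 0 < s.re) :
    Integrable (uncurry (auxG s ν))
      ((volume.restrict (Ioi (0:ℝ))).prod (volume.restrict (Ioi (0:ℝ)))) := by
  have hm : Measurable (uncurry (auxG s ν)) := by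
    unfold auxG uncurry; fun_prop
  have hw : 0 < (s + ν).re := by simp [hν, hs]
  rw [integrable_prod_iff hm.aestronglyMeasurable]
  constructor
  · filter_upwards [ae_restrict_mem measurableSet_Ioi] with x hx
    simp only [uncurry, auxG]
    exact (aux_gauss_int hw hx).const_mul _
  · have h := Real.GammaIntegral_convergent (s := s.re / 2) (by linarith)
    refine IntegrableOn.congr_fun (h.const_mul (‖(2:ℂ) ^ s‖ * (1/2 * Real.Gamma (s.re / 2))))
      (fun x hx => ?_) measurableSet_Ioi
    have hx' : 0 < x := hx
    simp only [uncurry, auxG]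
    simp_rw [norm_mul ((2:ℂ) ^ s * _)]
    rw [integral_const_mul, aux_gauss_norm hw hx, norm_mul, norm_mul, Complex.norm_real,
      Complex.norm_cpow_eq_rpow_re_of_pos hx, Real.norm_of_nonneg (Real.exp_pos _).le]
    have : x ^ (s.re / 2 - 1) = x ^ (s.re - 1) * x ^ (-(s.re / 2)) := by
      rw [← Real.rpow_add hx']; congr 1; ring
    simp only [Complex.add_re, hν, add_zero, Complex.sub_re, Complex.one_re]
    rw [this]; ring

lemma auxG_val {s ν : ℂ} (hν : ν.re = 0) (hs : 0 < s.re) :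
    (∫ x in Ioi (0:ℝ), ∫ t in Ioi (0:ℝ), auxG s ν x t) =
      (2:ℂ) ^ s * (1/2) * Complex.Gamma ((s+ν)/2) * Complex.Gamma ((s-ν)/2) := by
  have hw : 0 < (s + ν).re := by simp [hν, hs]
  have hw' : 0 < ((s - ν) / 2).re := by simp [hν, hs]
  rw [Complex.Gamma_eq_integral hw', Complex.GammaIntegral, ← integral_const_mul]
  refine setIntegral_congr_fun measurableSet_Ioi (fun x hx => ?_)
  have hx' : 0 < x := hx
  simp only [auxG]
  rw [integral_const_mul, aux_gauss hw hx]
  have : (x:ℂ) ^ ((s - ν) / 2 - 1) = (x:ℂ) ^ (s - 1) * (1 / x : ℂ) ^ ((s + ν) / 2) := by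
    rw [one_div, Complex.inv_cpow _ _ (by
      rw [Complex.arg_ofReal_of_nonneg hx'.le]; exact Real.pi_pos.ne),
      ← Complex.cpow_neg, ← Complex.cpow_add _ _ (by exact_mod_cast hx'.ne')]
    congr 1; ring
  rw [this]; push_cast; ring

noncomputable def auxF (s ν : ℂ) (y t : ℝ) : ℂ :=
  ((y:ℂ) ^ (s - 1)) * ((Real.exp (-(y * (t + 1/t) / 2)) : ℂ) * (t : ℂ) ^ (ν - 1))

lemma auxF_main {s ν : ℂ} (hν : ν.re = 0) (hs : 0 < s.re) :
    Integrable (uncurry (auxF s ν))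
      ((volume.restrict (Ioi (0:ℝ))).prod (volume.restrict (Ioi (0:ℝ)))) ∧
    (∫ y in Ioi (0:ℝ), ∫ t in Ioi (0:ℝ), auxF s ν y t)
      = ∫ x in Ioi (0:ℝ), ∫ t in Ioi (0:ℝ), auxG s ν x t := by
  refine aux_scale (by unfold auxF uncurry; fun_prop) (auxG_int hν hs) ?_
  intro x hx t ht
  unfold auxF auxG
  have e : -(2 * t * x * (t + 1 / t) / 2) = -x + -(x * t ^ 2) := by field_simp; ring
  have hx0 : (x:ℂ) ≠ 0 := by exact_mod_cast hx.ne'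
  have ht0 : (t:ℂ) ≠ 0 := by exact_mod_cast ht.ne'
  rw [e, Real.exp_add, Complex.ofReal_mul (2 * t) x, Complex.mul_cpow_ofReal_nonneg (by positivity) hx.le,
    Complex.ofReal_mul 2 t, Complex.mul_cpow_ofReal_nonneg (by positivity) ht.le]
  rw [show s + ν - 1 = (s - 1) + (ν - 1) + 1 by ring, Complex.cpow_add _ _ ht0,
    Complex.cpow_add _ _ ht0, Complex.cpow_one]
  have : (2:ℂ) ^ s = (2:ℂ) ^ (s - 1) * 2 := by
    nth_rewrite 3 [← Complex.cpow_one (2:ℂ)]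
    rw [← Complex.cpow_add _ _ (by norm_num)]; congr 1; ring
  rw [this]; push_cast; ring

lemma besselK_mellin {s ν : ℂ} (hν : ν.re = 0) (hs : 0 < s.re) :
    MellinConvergent (besselK ν) s ∧
    mellin (besselK ν) s = (2:ℂ) ^ s * (1/4) * Complex.Gamma ((s+ν)/2) * Complex.Gamma ((s-ν)/2) := by
  obtain ⟨h1, h2⟩ := auxF_main hν hs
  have e : ∀ y : ℝ, (y:ℂ) ^ (s - 1) • besselK ν y = (1/2) * ∫ t in Ioi (0:ℝ), auxF s ν y t := by
    intro y
    simp only [auxF, besselK, smul_eq_mul]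
    rw [integral_const_mul]; ring
  constructor
  · unfold MellinConvergent
    simp_rw [e]
    exact (h1.integral_prod_left).const_mul _
  · unfold mellin
    simp_rw [e]
    rw [integral_const_mul, h2, auxG_val hν hs]; ring

lemma besselK_bound {ν : ℂ} (hν : ν.re = 0) {y : ℝ} (hy : 0 < y) :
    ‖besselK ν y‖ ≤ 8 / y ^ 2 * Real.exp (-(y/2)) := by
  have hi := (integrableOn_exp_mul_Ioi (a := -(y/4)) (by linarith) 0).const_mul
    (Real.exp (-(y/2)) * (4 / y))
  have hv := integral_exp_mul_Ioi (a := -(y/4)) (by linarith) 0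
  have hb : ‖∫ t in Ioi (0:ℝ), (Real.exp (-(y * (t + 1/t) / 2)) : ℂ) * (t : ℂ) ^ (ν - 1)‖ ≤
      ∫ t in Ioi (0:ℝ), (Real.exp (-(y/2)) * (4 / y)) * Real.exp (-(y/4) * t) := by
    refine norm_integral_le_of_norm_le hi ?_
    filter_upwards [ae_restrict_mem measurableSet_Ioi] with t ht
    have ht : 0 < t := ht
    rw [norm_mul, Complex.norm_real, Complex.norm_cpow_eq_rpow_re_of_pos ht,
      Real.norm_of_nonneg (Real.exp_pos _).le]
    simp only [Complex.sub_re, hν, Complex.one_re, zero_sub, Real.rpow_neg_one]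
    have h1 : Real.exp (-(y / (4 * t))) * t⁻¹ ≤ 4 / y := by
      have := Real.add_one_le_exp (y / (4 * t))
      have h3 : y / (4 * t) ≤ Real.exp (y / (4 * t)) := by linarith
      rw [Real.exp_neg, ← mul_inv, inv_le_comm₀ (by positivity) (by positivity)]
      calc (4 / y)⁻¹ = y / (4 * t) * t := by field_simp
        _ ≤ _ := by gcongr
    have h2 : Real.exp (-(y * (t + 1/t) / 2)) ≤
        Real.exp (-(y/2)) * Real.exp (-(y/4) * t) * Real.exp (-(y / (4 * t))) := by
      rw [← Real.exp_add, ← Real.exp_add]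
      gcongr
      have h4 : 2 ≤ t + 1 / t := by
        have : t + 1 / t - 2 = (t - 1) ^ 2 / t := by field_simp; ring
        have : 0 ≤ (t - 1) ^ 2 / t := by positivity
        linarith
      have h5 : y / (4 * t) = y / 4 * (1 / t) := by field_simp
      rw [h5]
      nlinarith
    calc _ ≤ Real.exp (-(y/2)) * Real.exp (-(y/4) * t) * Real.exp (-(y / (4 * t))) * t⁻¹ := by gcongr
      _ = Real.exp (-(y/2)) * Real.exp (-(y/4) * t) * (Real.exp (-(y / (4 * t))) * t⁻¹) := by ring
      _ ≤ Real.exp (-(y/2)) * Real.exp (-(y/4) * t) * (4 / y) := by gcongr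
      _ = _ := by ring
  rw [integral_const_mul, hv] at hb
  rw [besselK, norm_mul]
  simp only [one_div, norm_inv, Complex.norm_ofNat] at hb ⊢
  calc _ ≤ _ := mul_le_mul_of_nonneg_left hb (by norm_num)
    _ = _ := by simp; field_simp; norm_num

lemma aux_integrable_tsum {F : ℕ → ℝ → ℂ} {μ : Measure ℝ} (hF : ∀ n, Integrable (F n) μ)
    (hs : Summable fun n => ∫ y, ‖F n y‖ ∂μ) (hp : ∀ᵐ y ∂μ, Summable fun n => F n y) :
    Integrable (fun y => ∑' n, F n y) μ := by
  refine ⟨?_, ?_⟩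
  · refine aestronglyMeasurable_of_tendsto_ae Filter.atTop
      (f := fun N y => ∑ n ∈ Finset.range N, F n y) (fun N => ?_) ?_
    · exact Finset.aestronglyMeasurable_fun_sum _ (fun n _ => (hF n).1)
    · filter_upwards [hp] with y hy using hy.hasSum.tendsto_sum_nat
  · rw [HasFiniteIntegral]
    calc ∫⁻ y, ‖∑' n, F n y‖ₑ ∂μ ≤ ∫⁻ y, ∑' n, ‖F n y‖ₑ ∂μ :=
          lintegral_mono (fun y => enorm_tsum_le_tsum_enorm)
      _ = ∑' n, ∫⁻ y, ‖F n y‖ₑ ∂μ := lintegral_tsum (fun n => (hF n).1.enorm)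
      _ = ∑' n, ENNReal.ofReal (∫ y, ‖F n y‖ ∂μ) := by
          simp_rw [ofReal_integral_norm_eq_lintegral_enorm (hF _)]
      _ < ⊤ := hs.tsum_ofReal_lt_top

lemma aux_dirichlet {C A : ℝ} (a : ℕ → ℂ) (ha : ∀ n : ℕ, 1 ≤ n → ‖a n‖ ≤ C * (n : ℝ) ^ A)
    {σ : ℝ} (hs : A + 1 < σ) :
    Summable (fun n : ℕ => ‖a (n+1)‖ * ((n:ℝ)+1) ^ (-σ)) := by
  have h := ((summable_nat_add_iff 1).2 (Real.summable_nat_rpow (p := A - σ)|>.2 (by linarith))).mul_left C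
  refine Summable.of_nonneg_of_le (fun n => by positivity) (fun n => ?_) h
  have := ha (n+1) (by omega)
  push_cast at this ⊢
  calc _ ≤ C * ((n:ℝ)+1) ^ A * ((n:ℝ)+1) ^ (-σ) := by gcongr
    _ = _ := by rw [mul_assoc, ← Real.rpow_add (by positivity)]; rfl

theorem stmt_8 (ν : ℂ) (hν : ν.re = 0) (C A : ℝ) (hC : 0 ≤ C) (hA : 0 ≤ A)
    (a : ℕ → ℂ) (ha : ∀ n : ℕ, 1 ≤ n → ‖a n‖ ≤ C * (n : ℝ) ^ A)
    (s : ℂ) (hs : A + 1 < s.re) :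
    (∀ y : ℝ, 0 < y →
      Summable (fun n : ℕ => ‖a (n+1) * besselK ν (2 * π * ((n:ℝ)+1) * y)‖)) ∧
    IntegrableOn
      (fun y : ℝ => (∑' n : ℕ, a (n+1) * besselK ν (2 * π * ((n:ℝ)+1) * y)) * (y : ℂ) ^ (s - 1))
      (Set.Ioi 0) ∧
    Summable (fun n : ℕ => ‖a (n+1) * ((n:ℂ)+1) ^ (-s)‖) ∧
    ∫ y in Set.Ioi (0:ℝ),
        (∑' n : ℕ, a (n+1) * besselK ν (2 * π * ((n:ℝ)+1) * y)) * (y : ℂ) ^ (s - 1)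
      = (1/4) * (π:ℂ) ^ (-s) * Complex.Gamma ((s+ν)/2) * Complex.Gamma ((s-ν)/2)
          * ∑' n : ℕ, a (n+1) * ((n:ℂ)+1) ^ (-s) := by
  have hs0 : 0 < s.re := by linarith
  obtain ⟨hc, hm⟩ := besselK_mellin hν hs0
  have hD := aux_dirichlet a ha hs
  have hp : ∀ n : ℕ, (0:ℝ) < 2 * π * ((n:ℝ)+1) := fun n => by positivity
  have h1 : ∀ y : ℝ, 0 < y →
      Summable (fun n : ℕ => ‖a (n+1) * besselK ν (2 * π * ((n:ℝ)+1) * y)‖) := by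
    intro y hy
    have h := ((summable_nat_add_iff 1).2 (Real.summable_pow_mul_exp_neg_nat_mul ⌈A⌉₊
      (r := π * y) (by positivity))).mul_left (C * (8 / (2 * π * y) ^ 2))
    refine Summable.of_nonneg_of_le (fun n => norm_nonneg _) (fun n => ?_) h
    have h2 := ha (n+1) (by omega)
    have h3 := besselK_bound hν (mul_pos (hp n) hy)
    have hn : (1:ℝ) ≤ (n:ℝ) + 1 := by linarith [Nat.cast_nonneg (α := ℝ) n]
    push_cast at h2 ⊢
    have h4 : ((n:ℝ)+1) ^ A ≤ ((n:ℝ)+1) ^ ⌈A⌉₊ := by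
      rw [← Real.rpow_natCast]
      exact Real.rpow_le_rpow_of_exponent_le hn (Nat.le_ceil A)
    have h5 : 8 / (2 * π * ((n:ℝ)+1) * y) ^ 2 ≤ 8 / (2 * π * y) ^ 2 := by
      have h6 : 2 * π * y ≤ 2 * π * ((n:ℝ)+1) * y := by
        have : 0 < 2 * π * y := by positivity
        nlinarith
      exact div_le_div_of_nonneg_left (by norm_num) (by positivity)
        (pow_le_pow_left₀ (by positivity) h6 2)
    rw [norm_mul]
    calc _ ≤ (C * ((n:ℝ)+1) ^ ⌈A⌉₊) * (8 / (2 * π * y) ^ 2 *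
          Real.exp (-(2 * π * ((n:ℝ)+1) * y / 2))) :=
          mul_le_mul (h2.trans (by gcongr)) (h3.trans (by gcongr)) (norm_nonneg _) (by positivity)
      _ = _ := by
        rw [show -(2 * π * ((n:ℝ)+1) * y / 2) = -(π * y) * ((n:ℝ)+1) by ring]; ring
  set F : ℕ → ℝ → ℂ := fun n y => a (n+1) * besselK ν (2 * π * ((n:ℝ)+1) * y) * (y:ℂ) ^ (s-1) with hFdef
  have hFi : ∀ n, IntegrableOn (F n) (Ioi 0) := by
    intro n
    have := ((MellinConvergent.comp_mul_left (f := besselK ν) (s := s) (hp n)).2 hc).const_mul (a (n+1))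
    refine this.congr (ae_of_all _ fun y => ?_)
    simp only [hFdef, smul_eq_mul]; ring
  have hFv : ∀ n, ∫ y in Ioi (0:ℝ), F n y =
      ((1/4) * (π:ℂ) ^ (-s) * Complex.Gamma ((s+ν)/2) * Complex.Gamma ((s-ν)/2)) *
        (a (n+1) * ((n:ℂ)+1) ^ (-s)) := by
    intro n
    have h := mellin_comp_mul_left (besselK ν) s (hp n)
    have e : ∀ y : ℝ, F n y = a (n+1) * ((y:ℂ) ^ (s-1) • besselK ν (2 * π * ((n:ℝ)+1) * y)) := by
      intro y; simp only [hFdef, smul_eq_mul]; ring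
    simp_rw [e]
    rw [integral_const_mul]
    rw [mellin] at h
    rw [h, hm, Complex.ofReal_mul, Complex.mul_cpow_ofReal_nonneg (by positivity) (by positivity),
      Complex.ofReal_mul, Complex.mul_cpow_ofReal_nonneg (by positivity) (by positivity)]
    have h2 : (2:ℂ) ^ (-s) * (2:ℂ) ^ s = 1 := by
      rw [← Complex.cpow_add _ _ (by norm_num)]; simp
    simp only [smul_eq_mul]
    push_cast
    linear_combination (a (n+1) * (π:ℂ) ^ (-s) * ((n:ℂ)+1) ^ (-s) * (1/4) *
      Complex.Gamma ((s+ν)/2) * Complex.Gamma ((s-ν)/2)) * h2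
  have hFn : Summable fun n => ∫ y in Ioi (0:ℝ), ‖F n y‖ := by
    have key : ∀ n : ℕ, ∫ y in Ioi (0:ℝ), ‖F n y‖ =
        ((2 * π) ^ (-s.re) * ∫ u in Ioi (0:ℝ), ‖besselK ν u‖ * u ^ (s.re - 1)) *
          (‖a (n+1)‖ * ((n:ℝ)+1) ^ (-s.re)) := by
      intro n
      have h := integral_comp_mul_left_Ioi (fun u => ‖besselK ν u‖ * u ^ (s.re - 1)) 0 (hp n)
      rw [mul_zero, smul_eq_mul] at h
      have e : ∀ y ∈ Ioi (0:ℝ), ‖F n y‖ = (‖a (n+1)‖ * (2 * π * ((n:ℝ)+1)) ^ (1 - s.re)) *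
          (‖besselK ν (2 * π * ((n:ℝ)+1) * y)‖ * (2 * π * ((n:ℝ)+1) * y) ^ (s.re - 1)) := by
        intro y hy
        have hy' : 0 < y := hy
        simp only [hFdef, norm_mul]
        rw [Complex.norm_cpow_eq_rpow_re_of_pos hy, Real.mul_rpow (hp n).le hy'.le]
        have : (2 * π * ((n:ℝ)+1)) ^ (1 - s.re) * (2 * π * ((n:ℝ)+1)) ^ (s.re - 1) = 1 := by
          rw [← Real.rpow_add (hp n)]; simp
        simp only [Complex.sub_re, Complex.one_re]
        linear_combination (-(‖a (n+1)‖ * ‖besselK ν (2 * π * ((n:ℝ)+1) * y)‖ * y ^ (s.re - 1))) * this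
      rw [setIntegral_congr_fun measurableSet_Ioi e, integral_const_mul, h]
      have h3 : (2 * π * ((n:ℝ)+1)) ^ (1 - s.re) * (2 * π * ((n:ℝ)+1))⁻¹ =
          (2 * π) ^ (-s.re) * ((n:ℝ)+1) ^ (-s.re) := by
        rw [← Real.rpow_neg_one, ← Real.rpow_add (hp n), ← Real.mul_rpow (by positivity) (by positivity)]
        congr 1; ring
      linear_combination (‖a (n+1)‖ * ∫ u in Ioi (0:ℝ), ‖besselK ν u‖ * u ^ (s.re - 1)) * h3
    simp_rw [key]
    exact hD.mul_left _
  have hts : (fun y : ℝ => (∑' n : ℕ, a (n+1) * besselK ν (2 * π * ((n:ℝ)+1) * y)) * (y : ℂ) ^ (s - 1))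
      = fun y => ∑' n, F n y := by
    funext y; rw [← tsum_mul_right]
  refine ⟨h1, ?_, ?_, ?_⟩
  · rw [hts]
    refine aux_integrable_tsum hFi hFn ?_
    filter_upwards [ae_restrict_mem measurableSet_Ioi] with y hy
    exact (h1 y hy).of_norm.mul_right _
  · refine hD.congr (fun n => ?_)
    rw [norm_mul]
    have := Complex.norm_cpow_eq_rpow_re_of_pos (x := (n:ℝ)+1) (by positivity) (-s)
    push_cast at this
    rw [this, Complex.neg_re]
  · rw [hts, ← (hasSum_integral_of_summable_integral_norm hFi hFn).tsum_eq]
    simp_rw [hFv]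
    rw [tsum_mul_left]
end

section
/- Let ν ∈ ℂ be purely imaginary (Re ν = 0), let p > 0, ε ∈ {1, -1}, C ≥ 0, A ≥ 0, and let a : {1,2,3,...} → ℂ satisfy |a_n| ≤ C·n^A for all n ≥ 1. Define φ : (0,∞) → ℂ by φ(y) = Σ_{n≥1} a_n·√y·K_ν(2πny) (the series converges absolutely for each y > 0), and assume φ(y) = ε·φ(1/(py)) for all y > 0. Then: (i) for every s ∈ ℂ the integral F(s) = ∫_0^∞ φ(y) y^{s - 1/2} dy/y converges absolutely; (ii) F(s) = ε·p^{1/2 - s}·F(1 - s) for all s ∈ ℂ; and (iii) whenever Re s > A + 1, F(s) = (1/4)·π^{-s}·Γ((s+ν)/2)·Γ((s-ν)/2)·Σ_{n≥1} a_n n^{-s}. -/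
open MeasureTheory Real

lemma gauss_mellin {w : ℂ} (hw : 0 < w.re) {b : ℝ} (hb : 0 < b) :
    ∫ y in Set.Ioi (0:ℝ), (y:ℂ) ^ (w - 1) * (Real.exp (-b * y ^ 2) : ℂ)
      = (1/2) * (1 / (b:ℂ)) ^ (w/2) * Complex.Gamma (w/2) := by
  have h := mellin_comp_rpow (fun x : ℝ => (Real.exp (-b * x) : ℂ)) w 2
  have h2 := Complex.integral_cpow_mul_exp_neg_mul_Ioi (a := w/2) (r := b)
    (by simp; linarith) hb
  have e1 : mellin (fun x : ℝ => (Real.exp (-b * x) : ℂ)) (w / (2:ℝ))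
      = (1 / (b:ℂ)) ^ (w/2) * Complex.Gamma (w/2) := by
    rw [← h2]
    unfold mellin
    simp
  rw [e1] at h
  have e2 : ∫ y in Set.Ioi (0:ℝ), (y:ℂ) ^ (w - 1) * (Real.exp (-b * y ^ 2) : ℂ)
      = mellin (fun t : ℝ => (Real.exp (-b * t ^ (2:ℝ)) : ℂ)) w := by
    unfold mellin
    simp
  rw [e2, h]
  simp
  ring

lemma gauss_norm {w : ℂ} {b y : ℝ} (hy : 0 < y) :
    ‖(y:ℂ) ^ (w - 1) * (Real.exp (-b * y ^ 2) : ℂ)‖ = y ^ (w.re - 1) * Real.exp (-b * y ^ 2) := by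
  rw [norm_mul, Complex.norm_cpow_eq_rpow_re_of_pos hy, Complex.norm_real, Real.norm_eq_abs,
    abs_of_pos (Real.exp_pos _)]
  simp

lemma gauss_int {w : ℂ} (hw : 0 < w.re) {b : ℝ} (hb : 0 < b) :
    IntegrableOn (fun y : ℝ => (y:ℂ) ^ (w - 1) * (Real.exp (-b * y ^ 2) : ℂ)) (Set.Ioi 0) := by
  have h := integrableOn_rpow_mul_exp_neg_mul_sq hb (s := w.re - 1) (by linarith)
  refine Integrable.mono' h ?_ ?_
  · apply Measurable.aestronglyMeasurable
    fun_prop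
  · filter_upwards [self_mem_ae_restrict measurableSet_Ioi] with y hy
    rw [gauss_norm hy]

lemma gauss_norm_int {w : ℂ} (hw : 0 < w.re) {b : ℝ} (hb : 0 < b) :
    ∫ y in Set.Ioi (0:ℝ), ‖(y:ℂ) ^ (w - 1) * (Real.exp (-b * y ^ 2) : ℂ)‖
      = b ^ (-w.re/2) * (1/2) * Real.Gamma (w.re/2) := by
  have h := integral_rpow_mul_exp_neg_mul_rpow (p := 2) (q := w.re - 1) two_pos (by linarith) hb
  rw [sub_add_cancel] at h
  rw [← h]
  refine setIntegral_congr_fun measurableSet_Ioi fun y hy => ?_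
  simp only [gauss_norm hy, Real.rpow_two]

/-- the two variable integrand -/
noncomputable def bigG (ν s : ℂ) (y u : ℝ) : ℂ :=
  (Real.exp (-u) : ℂ) * (u:ℂ) ^ (ν - 1) *
    ((y:ℂ) ^ (s - ν - 1) * (Real.exp (-(1/(4*u)) * y ^ 2) : ℂ))

lemma bigG_int {ν s : ℂ} (hν : ν.re = 0) (hs : 0 < s.re) :
    Integrable (Function.uncurry (bigG ν s))
      ((volume.restrict (Set.Ioi (0:ℝ))).prod (volume.restrict (Set.Ioi (0:ℝ)))) := by
  have hw : 0 < (s - ν).re := by simp [hν, hs]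
  have hm : Measurable (Function.uncurry (bigG ν s)) := by
    unfold bigG Function.uncurry
    fun_prop
  rw [integrable_prod_iff' hm.aestronglyMeasurable]
  constructor
  · filter_upwards [self_mem_ae_restrict measurableSet_Ioi] with u hu
    have hu : 0 < u := hu
    exact (gauss_int hw (b := 1/(4*u)) (by positivity)).const_mul
      ((Real.exp (-u) : ℂ) * (u:ℂ) ^ (ν - 1))
  · have h := (Real.GammaIntegral_convergent (s := s.re/2) (by linarith)).const_mul
      ((4:ℝ)^(s.re/2) * (1/2) * Real.Gamma (s.re/2))
    refine Integrable.congr h ?_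
    filter_upwards [self_mem_ae_restrict measurableSet_Ioi] with u hu
    have hu : 0 < u := hu
    simp only [Function.uncurry, bigG]
    simp_rw [norm_mul (_ * _) (_ * _)]
    rw [integral_const_mul, gauss_norm_int hw (by positivity)]
    rw [norm_mul, Complex.norm_cpow_eq_rpow_re_of_pos hu, Complex.norm_real, Real.norm_eq_abs,
      abs_of_pos (Real.exp_pos _)]
    have e : (s - ν).re = s.re := by simp [hν]
    have e' : (ν - 1).re = -1 := by simp [hν]
    rw [e, e', one_div (4*u), Real.inv_rpow (by positivity), ← Real.rpow_neg (by positivity),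
      Real.mul_rpow (by norm_num) hu.le, Real.rpow_sub hu, Real.rpow_neg_one, Real.rpow_one,
      show -(-s.re/2) = s.re/2 by ring]
    field_simp

lemma bigG_left {ν s : ℂ} {y : ℝ} (hy : 0 < y) :
    (y:ℂ) ^ (s - 1) * besselK ν y = (1/2) * (2:ℂ) ^ ν * ∫ u in Set.Ioi (0:ℝ), bigG ν s y u := by
  unfold besselK
  have h := integral_comp_mul_left_Ioi (fun u : ℝ => bigG ν s y u) 0 (b := y/2) (by positivity)
  rw [mul_zero] at h
  have h' : ∫ u in Set.Ioi (0:ℝ), bigG ν s y u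
      = ((y/2 : ℝ) : ℂ) * ∫ t in Set.Ioi (0:ℝ), bigG ν s y (y/2*t) := by
    rw [h, Complex.real_smul, ← mul_assoc, ← Complex.ofReal_mul, mul_inv_cancel₀ (by positivity)]
    simp
  rw [h', ← integral_const_mul, ← integral_const_mul, ← integral_const_mul, ← integral_const_mul]
  refine setIntegral_congr_fun measurableSet_Ioi fun t ht => ?_
  have ht : 0 < t := ht
  simp only [bigG]
  have hyc : (y:ℂ) ≠ 0 := by exact_mod_cast hy.ne'
  have h1 : Real.exp (-(y * (t + 1/t) / 2))
      = Real.exp (-(y/2*t)) * Real.exp (-(1/(4*(y/2*t))) * y^2) := by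
    rw [← Real.exp_add]
    congr 1
    field_simp
    ring
  have h2 : (((y/2*t : ℝ)) : ℂ) ^ (ν - 1) = (y:ℂ) ^ (ν-1) * ((2:ℂ) ^ (ν - 1))⁻¹ * (t:ℂ)^(ν-1) := by
    have : ((y/2*t : ℝ) : ℂ) = (y:ℂ) * (((1/2:ℝ) : ℂ) * (t:ℂ)) := by push_cast; ring
    rw [this, ← Complex.ofReal_mul, Complex.mul_cpow_ofReal_nonneg hy.le (by positivity),
      Complex.ofReal_mul, Complex.mul_cpow_ofReal_nonneg (by norm_num) ht.le]
    have h3 : ((1/2:ℝ) : ℂ) ^ (ν-1) = ((2:ℂ) ^ (ν - 1))⁻¹ := by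
      push_cast
      rw [one_div, Complex.inv_cpow]
      simpa using Real.pi_pos.ne
    rw [h3]; ring
  have h4 : (y:ℂ)^(s-1) = (y:ℂ)^(s-ν-1) * (y:ℂ)^(ν-1) * y := by
    rw [← Complex.cpow_add _ _ hyc]
    nth_rewrite 3 [← Complex.cpow_one (y:ℂ)]
    rw [← Complex.cpow_add _ _ hyc]
    congr 1; ring
  have h5 : (2:ℂ)^ν = 2 * 2^(ν-1) := by
    rw [Complex.cpow_sub _ _ two_ne_zero, Complex.cpow_one]; field_simp
  have h6 : (2:ℂ)^(ν-1) ≠ 0 := by simp [Complex.cpow_eq_zero_iff]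
  rw [h1, h2, h4, h5]
  push_cast
  field_simp

lemma bessel_mellin {ν s : ℂ} (hν : ν.re = 0) (hs : 0 < s.re) :
    IntegrableOn (fun y : ℝ => (y:ℂ) ^ (s - 1) * besselK ν y) (Set.Ioi 0) ∧
    ∫ y in Set.Ioi (0:ℝ), (y:ℂ) ^ (s - 1) * besselK ν y
      = (2:ℂ)^(s-2) * Complex.Gamma ((s+ν)/2) * Complex.Gamma ((s-ν)/2) := by
  have hw : 0 < (s - ν).re := by simp [hν, hs]
  have hG := bigG_int hν hs
  constructor
  · refine IntegrableOn.congr_fun (hG.integral_prod_left.const_mul ((1/2) * (2:ℂ) ^ ν)) ?_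
      measurableSet_Ioi
    intro y hy
    exact (bigG_left hy).symm
  · rw [setIntegral_congr_fun measurableSet_Ioi (fun y hy => bigG_left hy), integral_const_mul,
      integral_integral_swap hG]
    have h1 : ∀ u ∈ Set.Ioi (0:ℝ), ∫ y in Set.Ioi (0:ℝ), bigG ν s y u
        = (1/2) * (4:ℂ)^((s-ν)/2) * Complex.Gamma ((s-ν)/2) *
          ((Real.exp (-u) : ℂ) * (u:ℂ) ^ ((s+ν)/2-1)) := by
      intro u hu
      have hu : 0 < u := hu
      have huc : (u:ℂ) ≠ 0 := by exact_mod_cast hu.ne'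
      simp only [bigG]
      rw [integral_const_mul, gauss_mellin hw (by positivity)]
      have e : (1 / ((1/(4*u) : ℝ) : ℂ)) = ((4:ℝ):ℂ) * (u:ℂ) := by
        push_cast; simp
      rw [e, Complex.mul_cpow_ofReal_nonneg (by norm_num) hu.le,
        show (s+ν)/2-1 = (ν - 1) + (s-ν)/2 by ring, Complex.cpow_add _ _ huc]
      push_cast
      ring
    rw [setIntegral_congr_fun measurableSet_Ioi h1, integral_const_mul,
      Complex.Gamma_eq_integral (s := (s+ν)/2) (by simp [hν, hs])]
    have e4 : (4:ℂ)^((s-ν)/2) = 2^(s-ν) := by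
      rw [show (4:ℂ) = ((2:ℝ):ℂ) * ((2:ℝ):ℂ) by norm_num,
        Complex.mul_cpow_ofReal_nonneg (by norm_num) (by norm_num), 
        ← Complex.cpow_add _ _ (by norm_num)]
      push_cast
      congr 1; ring
    rw [e4, Complex.GammaIntegral]
    have e5 : (2:ℂ)^(s-2) = (1/4) * (2^ν * 2^(s-ν)) := by
      rw [← Complex.cpow_add _ _ two_ne_zero, Complex.cpow_sub _ _ two_ne_zero]
      simp
      norm_num
      ring
    rw [e5]
    ring

lemma integrable_tsum_aux {α : Type*} [MeasurableSpace α] {μ : Measure α} {F : ℕ → α → ℂ}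
    (hF_int : ∀ i, Integrable (F i) μ) (hF_sum : Summable fun i ↦ ∫ a, ‖F i a‖ ∂μ) :
    Integrable (fun a => ∑' i, F i a) μ := by
  have h1 : ∑' i, ∫⁻ a, ‖F i a‖ₑ ∂μ ≠ ⊤ := by
    have (i : ℕ) : ∫⁻ a, ‖F i a‖ₑ ∂μ = ENNReal.ofReal (∫ a, ‖F i a‖ ∂μ) := by
      rw [ofReal_integral_norm_eq_lintegral_enorm (hF_int i)]
    rw [funext this]
    exact hF_sum.tsum_ofReal_ne_top
  have h2 : ∫⁻ a, ∑' i, ‖F i a‖ₑ ∂μ ≠ ⊤ := by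
    rwa [lintegral_tsum fun i => (hF_int i).1.enorm]
  have h3 : ∀ᵐ a ∂μ, ∑' i, ‖F i a‖ₑ < ⊤ :=
    ae_lt_top' (AEMeasurable.tsum fun i => (hF_int i).1.enorm) h2
  constructor
  · refine aestronglyMeasurable_of_tendsto_ae Filter.atTop
      (f := fun (n:ℕ) a => ∑ i ∈ Finset.range n, F i a) (fun n => ?_) ?_
    · exact Finset.aestronglyMeasurable_fun_sum _ fun i _ => (hF_int i).1
    · filter_upwards [h3] with a ha
      exact (Summable.of_enorm ha.ne).tendsto_sum_tsum_nat
  · refine lt_of_le_of_lt (lintegral_mono fun a => ?_) h2.lt_top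
    exact enorm_tsum_le_tsum_enorm

lemma bessel_scale {ν s : ℂ} {c : ℝ} (hc : 0 < c) :
    ∫ y in Set.Ioi (0:ℝ), ‖(y:ℂ) ^ (s - 1) * besselK ν (c * y)‖
      = c ^ (-s.re) * ∫ y in Set.Ioi (0:ℝ), ‖(y:ℂ) ^ (s - 1) * besselK ν y‖ := by
  have h := integral_comp_mul_left_Ioi (fun y : ℝ => ‖(y:ℂ) ^ (s - 1) * besselK ν y‖) 0 hc
  rw [mul_zero] at h
  have h2 : ∫ y in Set.Ioi (0:ℝ), ‖((c * y : ℝ):ℂ) ^ (s - 1) * besselK ν (c * y)‖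
      = c ^ (s.re - 1) * ∫ y in Set.Ioi (0:ℝ), ‖(y:ℂ) ^ (s - 1) * besselK ν (c * y)‖ := by
    rw [← integral_const_mul]
    refine setIntegral_congr_fun measurableSet_Ioi fun y hy => ?_
    have hy : 0 < y := hy
    simp only [norm_mul]
    rw [Complex.norm_cpow_eq_rpow_re_of_pos hy, Complex.norm_cpow_eq_rpow_re_of_pos (by positivity),
      Real.mul_rpow hc.le hy.le]
    simp
    ring
  rw [h2] at h
  have hc' : c ^ s.re ≠ 0 := by positivity
  rw [Real.rpow_sub hc, Real.rpow_one, smul_eq_mul] at h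
  rw [Real.rpow_neg hc.le]
  field_simp at h ⊢
  exact h

lemma core (ν : ℂ) (hν : ν.re = 0) 
    (C A : ℝ) (hC : 0 ≤ C) (hA : 0 ≤ A)
    (a : ℕ → ℂ) (ha : ∀ n : ℕ, 1 ≤ n → ‖a n‖ ≤ C * (n:ℝ) ^ A)
    (φ : ℝ → ℂ)
    (hφ : ∀ y : ℝ, 0 < y →
      φ y = ∑' n : ℕ, a (n+1) * (Real.sqrt y : ℂ) * besselK ν (2*π*((n:ℝ)+1)*y))
    (s : ℂ) (hs : A + 1 < s.re) :
    IntegrableOn (fun y : ℝ => φ y * (y:ℂ) ^ (s - 3/2)) (Set.Ioi 0) ∧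
      ∫ y in Set.Ioi (0:ℝ), φ y * (y:ℂ) ^ (s - 3/2)
        = (1/4) * (π:ℂ) ^ (-s) * Complex.Gamma ((s+ν)/2) * Complex.Gamma ((s-ν)/2)
            * ∑' n : ℕ, a (n+1) * ((n:ℂ)+1) ^ (-s) := by
  have hs0 : 0 < s.re := by linarith
  obtain ⟨hb1, hb2⟩ := bessel_mellin hν hs0
  set F : ℕ → ℝ → ℂ := fun n y =>
    a (n+1) * ((y:ℂ) ^ (s - 1) * besselK ν (2*π*((n:ℝ)+1)*y)) with hF
  have hcn : ∀ n : ℕ, 0 < 2*π*((n:ℝ)+1) := fun n => by positivity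
  have hFint : ∀ n, Integrable (F n) (volume.restrict (Set.Ioi 0)) := by
    intro n
    refine Integrable.const_mul ?_ _
    exact (MellinConvergent.comp_mul_left (f := besselK ν) (s := s) (hcn n)).2 hb1
  have hFval : ∀ n, ∫ y in Set.Ioi (0:ℝ), F n y
      = (1/4) * (π:ℂ) ^ (-s) * Complex.Gamma ((s+ν)/2) * Complex.Gamma ((s-ν)/2)
          * (a (n+1) * ((n:ℂ)+1) ^ (-s)) := by
    intro n
    rw [hF, integral_const_mul]
    have h := mellin_comp_mul_left (besselK ν) s (hcn n)
    simp only [mellin, smul_eq_mul] at h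
    rw [h, hb2]
    have e : ((2*π*((n:ℝ)+1) : ℝ) : ℂ) ^ (-s) = (2:ℂ)^(-s) * (π:ℂ)^(-s) * ((n:ℂ)+1)^(-s) := by
      rw [Complex.ofReal_mul, Complex.mul_cpow_ofReal_nonneg (by positivity) (by positivity),
        Complex.ofReal_mul, Complex.mul_cpow_ofReal_nonneg (by positivity) (by positivity)]
      push_cast
      rfl
    have e2 : (2:ℂ)^(s-2) = (1/4) * (2:ℂ)^s := by
      rw [Complex.cpow_sub _ _ two_ne_zero]
      norm_num
      ring
    have e3 : (2:ℂ)^(-s) * (2:ℂ)^s = 1 := by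
      rw [← Complex.cpow_add _ _ two_ne_zero]; simp
    rw [e, e2]
    linear_combination (1/4) * a (n+1) * (π:ℂ)^(-s) * ((n:ℂ)+1)^(-s) * Complex.Gamma ((s+ν)/2) * Complex.Gamma ((s-ν)/2) * e3
  have hFsum : Summable fun n => ∫ y in Set.Ioi (0:ℝ), ‖F n y‖ := by
    set I := ∫ y in Set.Ioi (0:ℝ), ‖(y:ℂ) ^ (s - 1) * besselK ν y‖ with hI
    have hI0 : 0 ≤ I := integral_nonneg fun _ => norm_nonneg _
    have hsm : Summable fun n : ℕ => C * (2*π)^(-s.re) * I * ((n+1 : ℕ) : ℝ) ^ (A - s.re) := by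
      refine Summable.mul_left _ ?_
      exact (summable_nat_add_iff (f := fun n : ℕ => (n:ℝ)^(A - s.re)) 1).2
        (Real.summable_nat_rpow.2 (by linarith))
    refine Summable.of_nonneg_of_le (fun n => integral_nonneg fun _ => norm_nonneg _) (fun n => ?_) hsm
    simp only [hF]
    simp_rw [norm_mul (a _)]
    rw [integral_const_mul, bessel_scale (hcn n), ← hI, Real.mul_rpow (by positivity) (by positivity)]
    have h := ha (n+1) (by omega)
    have hn : (0:ℝ) < ((n+1 : ℕ) : ℝ) := by positivity
    rw [sub_eq_add_neg, Real.rpow_add hn]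
    have hn' : ((n:ℝ)+1) = ((n+1:ℕ):ℝ) := by push_cast; rfl
    rw [hn']
    calc _ ≤ (C * ((n+1 : ℕ) : ℝ)^A) * ((2*π)^(-s.re) * ((n+1 : ℕ) : ℝ)^(-s.re) * I) := by
            gcongr
      _ = _ := by ring
  have hcongr : ∀ y ∈ Set.Ioi (0:ℝ), φ y * (y:ℂ) ^ (s - 3/2) = ∑' n, F n y := by
    intro y hy
    have hy : 0 < y := hy
    have hyc : (y:ℂ) ≠ 0 := by exact_mod_cast hy.ne'
    rw [hφ y hy, ← tsum_mul_right]
    refine tsum_congr fun n => ?_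
    have e : ((Real.sqrt y : ℝ) : ℂ) = (y:ℂ)^((1:ℂ)/2) := by
      rw [Real.sqrt_eq_rpow, Complex.ofReal_cpow hy.le]; push_cast; rfl
    have e2 : (y:ℂ)^(s-1) = (y:ℂ)^((1:ℂ)/2) * (y:ℂ)^(s-3/2) := by
      rw [← Complex.cpow_add _ _ hyc]; congr 1; ring
    simp only [hF]
    rw [e, e2]; ring
  constructor
  · exact IntegrableOn.congr_fun (integrable_tsum_aux hFint hFsum)
      (fun y hy => (hcongr y hy).symm) measurableSet_Ioi
  · rw [setIntegral_congr_fun measurableSet_Ioi hcongr,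
      ← (hasSum_integral_of_summable_integral_norm hFint hFsum).tsum_eq]
    simp_rw [hFval]
    rw [tsum_mul_left]

lemma mellin_between {f : ℝ → ℂ} {w : ℂ} {M : ℝ} (hM : |w.re| ≤ M)
    (h1 : MellinConvergent f (M:ℂ)) (h2 : MellinConvergent f (-(M:ℂ))) : MellinConvergent f w := by
  unfold MellinConvergent at *
  simp only [smul_eq_mul] at *
  obtain ⟨hl, hr⟩ := abs_le.1 hM
  refine Integrable.mono' (h1.norm.add h2.norm) ?_ ?_
  · have hm : AEStronglyMeasurable (fun y : ℝ => (y:ℂ)^(w - M) * ((y:ℂ)^((M:ℂ) - 1) * f y))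
        (volume.restrict (Set.Ioi 0)) := by
      refine AEStronglyMeasurable.mul ?_ h1.1
      exact Measurable.aestronglyMeasurable (by fun_prop)
    refine hm.congr ?_
    filter_upwards [self_mem_ae_restrict measurableSet_Ioi] with y hy
    have hy : 0 < y := hy
    have hyc : (y:ℂ) ≠ 0 := by exact_mod_cast hy.ne'
    rw [← mul_assoc, ← Complex.cpow_add _ _ hyc]
    congr 2; ring
  · filter_upwards [self_mem_ae_restrict measurableSet_Ioi] with y hy
    have hy : 0 < y := hy
    simp only [Pi.add_apply, norm_mul]
    rw [Complex.norm_cpow_eq_rpow_re_of_pos hy, Complex.norm_cpow_eq_rpow_re_of_pos hy,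
      Complex.norm_cpow_eq_rpow_re_of_pos hy, ← add_mul]
    refine mul_le_mul_of_nonneg_right ?_ (norm_nonneg _)
    simp only [Complex.sub_re, Complex.ofReal_re, Complex.one_re, Complex.neg_re]
    have p1 : 0 ≤ y ^ (M - 1) := by positivity
    have p2 : 0 ≤ y ^ (-M - 1) := by positivity
    rcases le_total 1 y with h | h
    · have := Real.rpow_le_rpow_of_exponent_le h (show w.re - 1 ≤ M - 1 by linarith)
      linarith
    · have := Real.rpow_le_rpow_of_exponent_ge hy h (show -M - 1 ≤ w.re - 1 by linarith)
      linarith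

theorem stmt_10 (ν : ℂ) (hν : ν.re = 0) (p : ℝ) (hp : 0 < p) (ε : ℂ) (hε : ε = 1 ∨ ε = -1)
    (C A : ℝ) (hC : 0 ≤ C) (hA : 0 ≤ A)
    (a : ℕ → ℂ) (ha : ∀ n : ℕ, 1 ≤ n → ‖a n‖ ≤ C * (n:ℝ) ^ A)
    (φ : ℝ → ℂ)
    (hφ : ∀ y : ℝ, 0 < y →
      φ y = ∑' n : ℕ, a (n+1) * (Real.sqrt y : ℂ) * besselK ν (2*π*((n:ℝ)+1)*y))
    (hsym : ∀ y : ℝ, 0 < y → φ y = ε * φ (1/(p*y))) :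
    (∀ s : ℂ, IntegrableOn (fun y : ℝ => φ y * (y:ℂ) ^ (s - 3/2)) (Set.Ioi 0)) ∧
    (∀ s : ℂ, ∫ y in Set.Ioi (0:ℝ), φ y * (y:ℂ) ^ (s - 3/2)
        = ε * (p:ℂ) ^ ((1:ℂ)/2 - s) * ∫ y in Set.Ioi (0:ℝ), φ y * (y:ℂ) ^ ((1 - s) - 3/2)) ∧
    (∀ s : ℂ, A + 1 < s.re →
      ∫ y in Set.Ioi (0:ℝ), φ y * (y:ℂ) ^ (s - 3/2)
        = (1/4) * (π:ℂ) ^ (-s) * Complex.Gamma ((s+ν)/2) * Complex.Gamma ((s-ν)/2)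
            * ∑' n : ℕ, a (n+1) * ((n:ℂ)+1) ^ (-s)) := by
  have hcore := core ν hν C A hC hA a ha φ hφ
  have hfun : ∀ s : ℂ, (fun y : ℝ => φ y * (y:ℂ) ^ (s - 3/2))
      = fun y : ℝ => (y:ℂ) ^ ((s - 1/2) - 1) • φ y := by
    intro s
    funext y
    rw [smul_eq_mul, mul_comm, show s - 3/2 = s - 1/2 - 1 by ring]
  have hmell : ∀ s : ℂ, ∫ y in Set.Ioi (0:ℝ), φ y * (y:ℂ) ^ (s - 3/2) = mellin φ (s - 1/2) := by
    intro s
    rw [mellin, hfun]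
  have hsym' : ∀ w : ℂ, ∀ y ∈ Set.Ioi (0:ℝ),
      (y:ℂ)^(w-1) • (fun y => ε • (fun t => φ t⁻¹) (p * y)) y = (y:ℂ)^(w-1) • φ y := by
    intro w y hy
    simp only [smul_eq_mul]
    rw [hsym y hy, one_div]
  have hrefl : ∀ w : ℂ, MellinConvergent φ (-w) → MellinConvergent φ w := by
    intro w h
    have h1 : MellinConvergent (fun t => φ t⁻¹) w := by
      have := (MellinConvergent.comp_rpow (f := φ) (s := w) (a := -1) (by norm_num)).2
        (by simpa [div_neg] using h)
      simpa [Real.rpow_neg_one] using this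
    have h2 := ((MellinConvergent.comp_mul_left (f := fun t => φ t⁻¹) (s := w) hp).2 h1).const_smul ε
    exact IntegrableOn.congr_fun h2 (hsym' w) measurableSet_Ioi
  refine ⟨fun s => ?_, fun s => ?_, fun s hs => (hcore s hs).2⟩
  · rw [hfun]
    set M : ℝ := max |(s - 1/2).re| (A + 1) with hM
    have hMc : MellinConvergent φ (M:ℂ) := by
      have h := (hcore (M + 1/2) ?_).1
      · rw [hfun] at h
        simpa [MellinConvergent] using h
      · have := le_max_right |(s - 1/2).re| (A+1)
        simp
        linarith
    exact mellin_between (le_max_left _ _) hMc (hrefl _ (by rwa [neg_neg]))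
  · rw [hmell, hmell]
    have h1 : mellin φ (s - 1/2) = mellin (fun y => ε • (fun t => φ t⁻¹) (p * y)) (s-1/2) :=
      (setIntegral_congr_fun measurableSet_Ioi (hsym' (s - 1/2))).symm
    rw [h1, mellin_const_smul, mellin_comp_mul_left (fun t => φ t⁻¹) _ hp, mellin_comp_inv, smul_eq_mul,
      smul_eq_mul, mul_assoc, show -(s - 1/2) = 1/2 - s by ring,
      show 1 - s - 1/2 = 1/2 - s by ring]
end
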